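/- Assume that ψ is bounded from below on dom φ, that φ is bounded below by an affine function, that ψ is uniformly continuous on the sublevel set L_ψ(x⁰) := {x ∈ 𝕏 | ψ(x) ≤ ψ(x⁰)}, and that φ is continuous on dom φ. Let {x^k} with parameters {γ_k} be generated by the nonmonotone proximal gradient method and let x* be an accumulation point with x^k → x* along a subsequence k ∈ K. Then x* is an M-stationary point, i.e., x* ∈ dom φ and 0 ∈ ∇f(x*) + ∂φ(x*), and moreover γ_k (x^{k+1} − x^k) → 0 along k ∈ K. (Theorem 4.5.) -/

import Mathlib

open Filter Topology RealInnerProductSpace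

noncomputable section

variable {E : Type*} [NormedAddCommGroup E] [InnerProductSpace ℝ E] [FiniteDimensional ℝ E]

/-- The objective `ψ = f + φ`, with values in `EReal`. -/
def psi (f : E → ℝ) (φ : E → EReal) (x : E) : EReal :=
  (f x : EReal) + φ x

/-- `φ` is bounded from below by an affine function. -/
def AffineBoundedBelow (φ : E → EReal) : Prop :=
  ∃ (a : E) (b : ℝ), ∀ x : E, ((⟪a, x⟫ + b : ℝ) : EReal) ≤ φ x

/-- Objective of the proximal subproblem at `xb` with parameter `γ`. -/
def proxObj (f : E → ℝ) (φ : E → EReal) (xb : E) (γ : ℝ) (x : E) : EReal :=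
  ((f xb + ⟪gradient f xb, x - xb⟫ + γ / 2 * ‖x - xb‖ ^ 2 : ℝ) : EReal) + φ x

/-- `x` is a global minimizer of the proximal subproblem at `xb` with parameter `γ`. -/
def IsProxMin (f : E → ℝ) (φ : E → EReal) (xb : E) (γ : ℝ) (x : E) : Prop :=
  ∀ y : E, proxObj f φ xb γ x ≤ proxObj f φ xb γ y

/-- Fréchet (regular) subdifferential of `φ` at `x`. -/
def FrechetSubdiff (φ : E → EReal) (x : E) : Set E :=
  {η : E | ∀ ε : ℝ, 0 < ε →
    ∀ᶠ y in 𝓝[≠] x, φ x + ((⟪η, y - x⟫ - ε * ‖y - x‖ : ℝ) : EReal) ≤ φ y}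

/-- Limiting (Mordukhovich) subdifferential of `φ` at `x`. -/
def LimitingSubdiff (φ : E → EReal) (x : E) : Set E :=
  {η : E | ∃ u v : ℕ → E,
    Tendsto u atTop (𝓝 x) ∧
    Tendsto (fun j => φ (u j)) atTop (𝓝 (φ x)) ∧
    Tendsto v atTop (𝓝 η) ∧
    ∀ j : ℕ, v j ∈ FrechetSubdiff φ (u j)}

/-- `x` is an M-stationary point of `min f + φ`. -/
def MStationary (f : E → ℝ) (φ : E → EReal) (x : E) : Prop :=
  φ x ≠ ⊤ ∧ -gradient f x ∈ LimitingSubdiff φ x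

/-- `ψ` is bounded from below on `dom φ`. -/
def PsiBddBelow (f : E → ℝ) (φ : E → EReal) : Prop :=
  ∃ c : ℝ, ∀ z : E, φ z ≠ ⊤ → (c : EReal) ≤ psi f φ z

/-- The monotone proximal gradient method (Algorithm 3.1). -/
structure MonoPG (f : E → ℝ) (φ : E → EReal) (τ γmin γmax δ : ℝ)
    (x : ℕ → E) (γ : ℕ → ℝ) : Prop where
  dom : ∀ k : ℕ, φ (x k) ≠ ⊤
  stepsize : ∀ k : ℕ, ∃ γ0 : ℝ, ∃ i : ℕ, γ0 ∈ Set.Icc γmin γmax ∧ γ k = τ ^ i * γ0 ∧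
    (1 ≤ i → ∃ xh : E, IsProxMin f φ (x k) (γ k / τ) xh ∧
      psi f φ (x k) < psi f φ xh + ((δ * (γ k / τ) / 2 * ‖xh - x k‖ ^ 2 : ℝ) : EReal))
  isMin : ∀ k : ℕ, IsProxMin f φ (x k) (γ k) (x (k + 1))
  accept : ∀ k : ℕ,
    psi f φ (x (k + 1)) + ((δ * γ k / 2 * ‖x (k + 1) - x k‖ ^ 2 : ℝ) : EReal) ≤ psi f φ (x k)

/-- The nonmonotone reference value `max_{j=0,…,min{k,m}} ψ(x^{k-j})`. -/
def nmax (f : E → ℝ) (φ : E → EReal) (x : ℕ → E) (m k : ℕ) : EReal :=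
  (Finset.range (min k m + 1)).sup fun j => psi f φ (x (k - j))

/-- The nonmonotone proximal gradient method (Algorithm 4.1). -/
structure NonmonoPG (f : E → ℝ) (φ : E → EReal) (τ γmin γmax δ : ℝ) (m : ℕ)
    (x : ℕ → E) (γ : ℕ → ℝ) : Prop where
  dom : ∀ k : ℕ, φ (x k) ≠ ⊤
  stepsize : ∀ k : ℕ, ∃ γ0 : ℝ, ∃ i : ℕ, γ0 ∈ Set.Icc γmin γmax ∧ γ k = τ ^ i * γ0 ∧
    (1 ≤ i → ∃ xh : E, IsProxMin f φ (x k) (γ k / τ) xh ∧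
      nmax f φ x m k < psi f φ xh + ((δ * (γ k / τ) / 2 * ‖xh - x k‖ ^ 2 : ℝ) : EReal))
  isMin : ∀ k : ℕ, IsProxMin f φ (x k) (γ k) (x (k + 1))
  accept : ∀ k : ℕ,
    psi f φ (x (k + 1)) + ((δ * γ k / 2 * ‖x (k + 1) - x k‖ ^ 2 : ℝ) : EReal) ≤ nmax f φ x m k

/-- `l` realizes the nonmonotone maximum `ψ(x^{l(k)}) = max_{j=0,…,m_k} ψ(x^{k-j})`,
with `l k ∈ {k - m_k, …, k}`. -/
def RealizesNMax (f : E → ℝ) (φ : E → EReal) (x : ℕ → E) (m : ℕ) (l : ℕ → ℕ) : Prop :=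
  ∀ k : ℕ, k - min k m ≤ l k ∧ l k ≤ k ∧ psi f φ (x (l k)) = nmax f φ x m k

/-- `ψ` is uniformly continuous on the sublevel set `L_ψ(x⁰)`. -/
def UnifContOnLevelSet (f : E → ℝ) (φ : E → EReal) (x0 : E) : Prop :=
  ∀ ε : ℝ, 0 < ε → ∃ η : ℝ, 0 < η ∧ ∀ u v : E,
    psi f φ u ≤ psi f φ x0 → psi f φ v ≤ psi f φ x0 → ‖u - v‖ ≤ η →
    psi f φ u ≤ psi f φ v + (ε : EReal)

/-- `φ` is continuous on its domain `dom φ`. -/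
def ContOnDom (φ : E → EReal) : Prop :=
  ∀ x : E, φ x ≠ ⊤ → ∀ y : ℕ → E, (∀ j : ℕ, φ (y j) ≠ ⊤) →
    Tendsto y atTop (𝓝 x) → Tendsto (fun j => φ (y j)) atTop (𝓝 (φ x))

theorem aux_mono (p d : ℕ → ℝ) (l : ℕ → ℕ) (m : ℕ) (c : ℝ) (hc : 0 < c)
    (hl1 : ∀ k, k - min k m ≤ l k) (hl2 : ∀ k, l k ≤ k)
    (hmax : ∀ k i, k - min k m ≤ i → i ≤ k → p i ≤ p (l k))
    (hacc : ∀ k, p (k + 1) + c * d k ^ 2 ≤ p (l k)) :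
    Antitone (fun k => p (l k)) := by
  apply antitone_nat_of_succ_le
  intro k
  have h1 := hl1 (k + 1)
  have h2 := hl2 (k + 1)
  rcases Nat.lt_or_ge (l (k + 1)) (k + 1) with h | h
  · exact hmax k _ (by omega) (by omega)
  · have h3 : l (k + 1) = k + 1 := by omega
    have h4 : 0 ≤ c * d k ^ 2 := by positivity
    have := hacc k
    show p (l (k + 1)) ≤ p (l k)
    rw [h3]; linarith

theorem aux_le (p d : ℕ → ℝ) (l : ℕ → ℕ) (m : ℕ) (c : ℝ) (hc : 0 < c)
    (hl1 : ∀ k, k - min k m ≤ l k) (hl2 : ∀ k, l k ≤ k)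
    (hmax : ∀ k i, k - min k m ≤ i → i ≤ k → p i ≤ p (l k))
    (hacc : ∀ k, p (k + 1) + c * d k ^ 2 ≤ p (l k)) (k : ℕ) : p k ≤ p 0 := by
  have h := aux_mono p d l m c hc hl1 hl2 hmax hacc (Nat.zero_le k)
  have h0 : l 0 = 0 := by have := hl2 0; omega
  have h1 := hmax k k (by omega) le_rfl
  simp only [h0] at h
  linarith

theorem aux_sq (d : ℕ → ℝ) (c : ℝ) (hc : 0 < c) (hd : ∀ k, 0 ≤ d k) (b : ℕ → ℝ)
    (hb : Tendsto b atTop (𝓝 0)) (h : ∀ᶠ k in atTop, c * d k ^ 2 ≤ b k) :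
    Tendsto d atTop (𝓝 0) := by
  rw [Metric.tendsto_atTop'] at *
  intro ε hε
  obtain ⟨N, hN⟩ := hb (c * ε ^ 2) (by positivity)
  obtain ⟨N', hN'⟩ := eventually_atTop.1 h
  refine ⟨max N N', fun n hn => ?_⟩
  have h1 := hN n (lt_of_le_of_lt (le_max_left _ _) hn)
  have h2 := hN' n (le_of_lt (lt_of_le_of_lt (le_max_right _ _) hn))
  rw [Real.dist_eq, sub_zero] at *
  have h3 := lt_of_abs_lt h1
  have h4 : d n ^ 2 < ε ^ 2 := by
    by_contra hh
    push Not at hh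
    nlinarith
  rw [abs_of_nonneg (hd n)]
  exact lt_of_pow_lt_pow_left₀ 2 hε.le h4

theorem aux_lim (p d : ℕ → ℝ) (l : ℕ → ℕ) (m : ℕ) (c : ℝ) (hc : 0 < c) (hd : ∀ k, 0 ≤ d k)
    (hl1 : ∀ k, k - min k m ≤ l k) (hl2 : ∀ k, l k ≤ k)
    (hmax : ∀ k i, k - min k m ≤ i → i ≤ k → p i ≤ p (l k))
    (hacc : ∀ k, p (k + 1) + c * d k ^ 2 ≤ p (l k))
    (q : ℝ) (hq : ∀ k, q ≤ p k)
    (huc : ∀ ε : ℝ, 0 < ε → ∃ η : ℝ, 0 < η ∧ ∀ k, d k ≤ η → |p (k + 1) - p k| ≤ ε) :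
    Tendsto d atTop (𝓝 0) := by
  have hanti := aux_mono p d l m c hc hl1 hl2 hmax hacc
  obtain ⟨L, hL⟩ : ∃ L, Tendsto (fun k => p (l k)) atTop (𝓝 L) :=
    ⟨_, tendsto_atTop_ciInf hanti ⟨q, by rintro _ ⟨k, rfl⟩; exact hq _⟩⟩
  have hgo : ∀ j, Tendsto (fun k => l k - j) atTop atTop := by
    intro j
    apply tendsto_atTop_mono (f := fun k => k - (m + j))
    · intro k
      have := hl1 k
      omega
    · exact tendsto_sub_atTop_nat _
  have hj : ∀ j, Tendsto (fun k => p (l k - j)) atTop (𝓝 L) := by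
    intro j
    induction j with
    | zero => simpa using hL
    | succ j ih =>
      have hM : Tendsto (fun k => p (l (l k - (j + 1)))) atTop (𝓝 L) := hL.comp (hgo (j + 1))
      have hb : Tendsto (fun k => p (l (l k - (j + 1))) - p (l k - j)) atTop (𝓝 0) := by
        simpa using hM.sub ih
      have hev : ∀ᶠ k in atTop, l k - j = (l k - (j + 1)) + 1 := by
        filter_upwards [(hgo j).eventually_ge_atTop 1] with k hk
        omega
      have hdt : Tendsto (fun k => d (l k - (j + 1))) atTop (𝓝 0) := by
        apply aux_sq _ c hc (fun k => hd _) _ hb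
        filter_upwards [hev] with k hk
        have := hacc (l k - (j + 1))
        rw [← hk] at this
        linarith
      have hdiff : Tendsto (fun k => p (l k - j) - p (l k - (j + 1))) atTop (𝓝 0) := by
        rw [Metric.tendsto_nhds]
        intro ε hε
        obtain ⟨η, hη, hh⟩ := huc (ε / 2) (by positivity)
        filter_upwards [hev, hdt.eventually_lt_const hη] with k hk hk2
        have := hh _ hk2.le
        rw [← hk] at this
        rw [Real.dist_eq, sub_zero]
        linarith
      simpa using ih.sub hdiff
  have hp : Tendsto p atTop (𝓝 L) := by
    rw [Metric.tendsto_nhds]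
    intro ε hε
    have h1 : ∀ᶠ k in atTop, ∀ j ∈ Finset.range (m + 1), dist (p (l k - j)) L < ε := by
      rw [Filter.eventually_all_finset]
      intro j _
      exact (Metric.tendsto_nhds.1 (hj j)) ε hε
    have h2 := (tendsto_add_atTop_nat m).eventually h1
    filter_upwards [h2] with k hk
    have a1 := hl1 (k + m)
    have a2 := hl2 (k + m)
    have := hk (l (k + m) - k) (by rw [Finset.mem_range]; omega)
    rwa [show l (k + m) - (l (k + m) - k) = k by omega] at this
  have hb : Tendsto (fun k => p (l k) - p (k + 1)) atTop (𝓝 0) := by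
    simpa using hL.sub (hp.comp (tendsto_add_atTop_nat 1))
  exact aux_sq d c hc hd _ hb (Eventually.of_forall fun k => by have := hacc k; linarith)

theorem aux_prox {f : E → ℝ} {φ : E → EReal} (hbot : ∀ z : E, φ z ≠ ⊥) {xb u : E} {γ : ℝ}
    (h : IsProxMin f φ xb γ u) {y : E} (hy : φ y ≠ ⊤) :
    φ u ≠ ⊤ ∧ ⟪gradient f xb, u - xb⟫ + γ / 2 * ‖u - xb‖ ^ 2 + (φ u).toReal ≤
      ⟪gradient f xb, y - xb⟫ + γ / 2 * ‖y - xb‖ ^ 2 + (φ y).toReal := by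
  have h1 := h y
  unfold proxObj at h1
  have e1 : φ y = ((φ y).toReal : EReal) := (EReal.coe_toReal hy (hbot y)).symm
  have hu : φ u ≠ ⊤ := by
    intro hu
    rw [hu, e1, ← EReal.coe_add, EReal.coe_add_top] at h1
    exact EReal.coe_ne_top _ (top_le_iff.1 h1)
  refine ⟨hu, ?_⟩
  have e2 : φ u = ((φ u).toReal : EReal) := (EReal.coe_toReal hu (hbot u)).symm
  rw [e1, e2, ← EReal.coe_add, ← EReal.coe_add, EReal.coe_le_coe_iff] at h1
  linarith

theorem aux_frechet {f : E → ℝ} {φ : E → EReal} (hbot : ∀ z : E, φ z ≠ ⊥) {xb u : E} {γ : ℝ}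
    (hγ : 0 < γ) (hu : φ u ≠ ⊤)
    (h : IsProxMin f φ xb γ u) :
    -gradient f xb - γ • (u - xb) ∈ FrechetSubdiff φ u := by
  intro ε hε
  have hball : ∀ᶠ y in 𝓝[≠] u, dist y u < 2 * ε / γ :=
    eventually_nhdsWithin_of_eventually_nhds (Metric.eventually_nhds_iff.2
      ⟨2 * ε / γ, by positivity, fun y hy => hy⟩)
  filter_upwards [hball] with y hy
  by_cases hyt : φ y = ⊤
  · rw [hyt]; exact le_top
  obtain ⟨-, h1⟩ := aux_prox hbot h hyt
  have e1 : φ y = ((φ y).toReal : EReal) := (EReal.coe_toReal hyt (hbot y)).symm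
  have e2 : φ u = ((φ u).toReal : EReal) := (EReal.coe_toReal hu (hbot u)).symm
  rw [e1, e2, ← EReal.coe_add, EReal.coe_le_coe_iff]
  have h2 : y - xb = (u - xb) + (y - u) := by abel
  rw [h2, norm_add_sq_real, inner_add_right] at h1
  rw [inner_sub_left, inner_neg_left, real_inner_smul_left]
  rw [dist_eq_norm, lt_div_iff₀ hγ] at hy
  have := norm_nonneg (y - u)
  nlinarith

theorem aux_strict {f : E → ℝ} (hf : ContDiff ℝ 1 f) (z : E) :
    Continuous (gradient f) ∧ ∀ ε : ℝ, 0 < ε → ∃ r : ℝ, 0 < r ∧ ∀ u v : E, dist u z < r →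
      dist v z < r → f v - f u - ⟪gradient f u, v - u⟫ ≤ ε * ‖v - u‖ := by
  have hg : Continuous (gradient f) := by
    unfold gradient
    exact (LinearIsometryEquiv.continuous _).comp (hf.continuous_fderiv (by norm_num))
  refine ⟨hg, fun ε hε => ?_⟩
  have hs : HasStrictFDerivAt f (fderiv ℝ f z) z :=
    hf.contDiffAt.hasStrictFDerivAt (by norm_num)
  have h1 := hs.isLittleO.def (half_pos hε)
  rw [Metric.eventually_nhds_iff] at h1
  obtain ⟨r1, hr1, h1⟩ := h1
  obtain ⟨r2, hr2, h2⟩ := Metric.continuous_iff.1 hg z (ε / 2) (half_pos hε)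
  refine ⟨min r1 r2, lt_min hr1 hr2, fun u v hu hv => ?_⟩
  have a1 := h1 (y := (v, u)) (by
    rw [Prod.dist_eq]
    exact max_lt (lt_of_lt_of_le hv (min_le_left _ _)) (lt_of_lt_of_le hu (min_le_left _ _)))
  have a2 := h2 u (lt_of_lt_of_le hu (min_le_right _ _))
  have a3 : fderiv ℝ f z (v - u) = ⟪gradient f z, v - u⟫ := by
    unfold gradient
    rw [InnerProductSpace.toDual_symm_apply]
  simp only [a3] at a1
  have a4 := le_of_abs_le a1
  have a5 : ⟪gradient f z - gradient f u, v - u⟫ ≤ ε / 2 * ‖v - u‖ := by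
    refine (real_inner_le_norm _ _).trans ?_
    rw [dist_comm, dist_eq_norm] at a2
    gcongr
  rw [inner_sub_left] at a5
  linarith

set_option maxHeartbeats 1000000

/-- Theorem 4.5: assume `ψ` is bounded below on `dom φ`, `φ` is bounded below by an affine
function, `ψ` is uniformly continuous on `L_ψ(x⁰)`, and `φ` is continuous on its domain.
If a subsequence `x^k`, `k ∈ K`, of iterates of the nonmonotone proximal gradient method
converges to `xstar`, then `xstar` is M-stationary and `γ_k (x^{k+1} - x^k) → 0`
along `k ∈ K`. -/
theorem stmt_18
    (f : E → ℝ) (φ : E → EReal) (hf : ContDiff ℝ 1 f)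
    (hbot : ∀ z : E, φ z ≠ ⊥) (hlsc : LowerSemicontinuous φ)
    (τ γmin γmax δ : ℝ) (m : ℕ) (hτ : 1 < τ) (hγmin : 0 < γmin) (hγmm : γmin ≤ γmax)
    (hδ : δ ∈ Set.Ioo (0 : ℝ) 1)
    (x : ℕ → E) (γ : ℕ → ℝ)
    (hpsibdd : PsiBddBelow f φ) (haff : AffineBoundedBelow φ)
    (hucont : UnifContOnLevelSet f φ (x 0))
    (hcont : ContOnDom φ)
    (hM : NonmonoPG f φ τ γmin γmax δ m x γ)
    (xstar : E) (K : ℕ → ℕ) (hK : StrictMono K)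
    (hconv : Tendsto (fun n => x (K n)) atTop (𝓝 xstar)) :
    MStationary f φ xstar ∧
    Tendsto (fun n => γ (K n) • (x (K n + 1) - x (K n))) atTop (𝓝 0) := by
  obtain ⟨hδ0, hδ1⟩ := hδ
  have hτ0 : 0 < τ := by linarith
  have hdom := hM.dom
  have hco : ∀ z, φ z ≠ ⊤ → φ z = ((φ z).toReal : EReal) :=
    fun z hz => (EReal.coe_toReal hz (hbot z)).symm
  have hpsi : ∀ z, φ z ≠ ⊤ → psi f φ z = ((f z + (φ z).toReal : ℝ) : EReal) := by
    intro z hz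
    unfold psi
    rw [hco z hz, ← EReal.coe_add, EReal.toReal_coe]
  set p : ℕ → ℝ := fun k => f (x k) + (φ (x k)).toReal with hp
  have hpk : ∀ k, psi f φ (x k) = (p k : EReal) := fun k => hpsi _ (hdom k)
  set d : ℕ → ℝ := fun k => ‖x (k + 1) - x k‖ with hd
  have hγ : ∀ k, γmin ≤ γ k := by
    intro k
    obtain ⟨γ0, i, h0, h1, -⟩ := hM.stepsize k
    rw [h1]
    have : 1 ≤ τ ^ i := one_le_pow₀ hτ.le
    nlinarith [h0.1]
  have hex : ∀ k, ∃ i, k - min k m ≤ i ∧ i ≤ k ∧ nmax f φ x m k = (p i : EReal) := by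
    intro k
    obtain ⟨j, hj, hj2⟩ := Finset.exists_mem_eq_sup (Finset.range (min k m + 1)) (by simp)
      (fun j => psi f φ (x (k - j)))
    rw [Finset.mem_range] at hj
    exact ⟨k - j, by omega, by omega, by unfold nmax; rw [hj2, hpk]⟩
  choose l hl1 hl2 hl3 using hex
  have hmax : ∀ k i, k - min k m ≤ i → i ≤ k → p i ≤ p (l k) := by
    intro k i h1 h2
    have : psi f φ (x (k - (k - i))) ≤ nmax f φ x m k :=
      Finset.le_sup (f := fun j => psi f φ (x (k - j))) (by rw [Finset.mem_range]; omega)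
    rw [show k - (k - i) = i by omega, hpk, hl3, EReal.coe_le_coe_iff] at this
    exact this
  have hc : 0 < δ * γmin / 2 := by positivity
  have hacc : ∀ k, p (k + 1) + δ * γmin / 2 * d k ^ 2 ≤ p (l k) := by
    intro k
    have h := hM.accept k
    rw [hpk, hl3, ← EReal.coe_add, EReal.coe_le_coe_iff] at h
    have : δ * γmin / 2 * d k ^ 2 ≤ δ * γ k / 2 * d k ^ 2 := by
      have := hγ k
      gcongr
    simp only [hd] at this ⊢
    linarith
  have hp0 := aux_le p d l m _ hc hl1 hl2 hmax hacc
  obtain ⟨q, hq⟩ := hpsibdd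
  have hd0 : Tendsto d atTop (𝓝 0) := by
    refine aux_lim p d l m _ hc (fun k => norm_nonneg _) hl1 hl2 hmax hacc q ?_ ?_
    · intro k
      have := hq _ (hdom k)
      rw [hpk, EReal.coe_le_coe_iff] at this
      exact this
    · intro ε hε
      obtain ⟨η, hη, hh⟩ := hucont ε hε
      refine ⟨η, hη, fun k hk => ?_⟩
      have hlev : ∀ k, psi f φ (x k) ≤ psi f φ (x 0) := by
        intro k
        rw [hpk, hpk, EReal.coe_le_coe_iff]
        exact hp0 k
      have h1 := hh _ _ (hlev (k + 1)) (hlev k) hk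
      have h2 := hh _ _ (hlev k) (hlev (k + 1)) (by rw [norm_sub_rev]; exact hk)
      rw [hpk, hpk, ← EReal.coe_add, EReal.coe_le_coe_iff] at h1 h2
      rw [abs_le]
      constructor <;> linarith
  have hdK : Tendsto (fun n => d (K n)) atTop (𝓝 0) := hd0.comp hK.tendsto_atTop
  have hdiff : Tendsto (fun n => x (K n + 1) - x (K n)) atTop (𝓝 0) :=
    tendsto_zero_iff_norm_tendsto_zero.2 hdK
  have hconv1 : Tendsto (fun n => x (K n + 1)) atTop (𝓝 xstar) := by
    simpa using hconv.add hdiff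
  have hfK : Tendsto (fun n => f (x (K n))) atTop (𝓝 (f xstar)) :=
    (hf.continuous.tendsto xstar).comp hconv
  have hstar : φ xstar ≠ ⊤ := by
    intro htop
    have h1 := hlsc xstar ((p 0 - f xstar + 1 : ℝ) : EReal) (by
      show _ < φ xstar
      rw [htop]; exact EReal.coe_lt_top _)
    have h2 := hconv.eventually h1
    have h3 := hfK.eventually_const_lt (show f xstar - 1 < f xstar by linarith)
    obtain ⟨n, h4, h5⟩ := (h2.and h3).exists
    have h4 : ((p 0 - f xstar + 1 : ℝ) : EReal) < φ (x (K n)) := h4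
    rw [hco _ (hdom _), EReal.coe_lt_coe_iff] at h4
    have := hp0 (K n)
    simp only [hp] at this h4
    linarith
  obtain ⟨hgc, hstrict⟩ := aux_strict hf xstar
  have hgK : Tendsto (fun n => gradient f (x (K n))) atTop (𝓝 (gradient f xstar)) :=
    (hgc.tendsto xstar).comp hconv
  obtain ⟨a, b, hab⟩ := haff
  have key : Tendsto (fun n => γ (K n) • (x (K n + 1) - x (K n))) atTop (𝓝 0) := by
    rw [Metric.tendsto_nhds]
    intro ε hε
    set ε' : ℝ := ε / τ * (1 - δ) / 4 with hε'
    have h1δ : 0 < 1 - δ := by linarith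
    have hε'0 : 0 < ε' := by positivity
    obtain ⟨r, hr, hstr⟩ := hstrict ε' hε'0
    set C1 : ℝ := |p 0 - f xstar - ⟪a, xstar⟫ - b + 1| with hC1
    have hC1e : ∀ᶠ n in atTop, p 0 - f (x (K n)) - ⟪a, x (K n)⟫ - b < C1 := by
      have : Tendsto (fun n => p 0 - f (x (K n)) - ⟪a, x (K n)⟫ - b) atTop
          (𝓝 (p 0 - f xstar - ⟪a, xstar⟫ - b)) :=
        ((hfK.const_sub (p 0)).sub (tendsto_const_nhds.inner hconv)).sub_const b
      exact this.eventually_lt_const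
        (lt_of_lt_of_le (by linarith) (le_abs_self (p 0 - f xstar - ⟪a, xstar⟫ - b + 1)))
    set C2 : ℝ := ‖gradient f xstar‖ + 1 + ‖a‖ with hC2
    have hC2e : ∀ᶠ n in atTop, ‖gradient f (x (K n))‖ < ‖gradient f xstar‖ + 1 :=
      hgK.norm.eventually_lt_const (by linarith)
    have hC10 : 0 ≤ C1 := abs_nonneg _
    set s : ℝ := r / 2 with hs
    have hs0 : 0 < s := by positivity
    set G : ℝ := 2 * (C1 / s + C2) / s with hG
    set B : ℝ := max (γmax + 1) (τ * (G + 1)) with hB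
    have hB0 : 0 < B := lt_of_lt_of_le (by linarith) (le_max_left _ _)
    have hdist := Metric.tendsto_nhds.1 hconv s hs0
    have hdBe := hdK.eventually_lt_const (show 0 < ε / B by positivity)
    filter_upwards [hC1e, hC2e, hdist, hdBe] with n h1 h2 h3 h4
    have hγn : 0 < γ (K n) := lt_of_lt_of_le hγmin (hγ _)
    rw [dist_zero_right, norm_smul, Real.norm_eq_abs, abs_of_pos hγn]
    rcases lt_or_ge (γ (K n)) B with hlt | hge
    · rw [lt_div_iff₀ hB0] at h4
      have := norm_nonneg (x (K n + 1) - x (K n))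
      simp only [hd] at h4
      nlinarith
    obtain ⟨γ0, i, hγ0, hγi, himp⟩ := hM.stepsize (K n)
    have hi : 1 ≤ i := by
      by_contra hi
      have hi0 : i = 0 := by omega
      rw [hi0, pow_zero, one_mul] at hγi
      have := le_max_left (γmax + 1) (τ * (G + 1))
      have := hγ0.2
      linarith
    obtain ⟨xh, hxh, hfail⟩ := himp hi
    obtain ⟨hxt, hpr⟩ := aux_prox hbot hxh (hdom (K n))
    simp only [sub_self, inner_zero_right, norm_zero] at hpr
    set t : ℝ := ‖xh - x (K n)‖ with ht
    set gh : ℝ := γ (K n) / τ with hgh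
    have hgh0 : 0 < gh := by positivity
    have ht0 : 0 ≤ t := norm_nonneg _
    have hγτ : γ (K n) = τ * gh := by rw [hgh]; field_simp
    have hghG : G + 1 ≤ gh := by
      rw [hgh, le_div_iff₀ hτ0]
      have := le_max_right (γmax + 1) (τ * (G + 1))
      linarith
    have hfail' : p (K n) < f xh + (φ xh).toReal + δ * gh / 2 * t ^ 2 := by
      rw [hl3, hpsi _ hxt, ← EReal.coe_add, EReal.coe_lt_coe_iff] at hfail
      have := hmax (K n) (K n) (by omega) le_rfl
      linarith
    have hts : t < s := by
      by_contra hh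
      push Not at hh
      have haf := hab xh
      rw [hco _ hxt, EReal.coe_le_coe_iff] at haf
      have e1 : ⟪a, xh⟫ = ⟪a, x (K n)⟫ + ⟪a, xh - x (K n)⟫ := by
        rw [← inner_add_right]; congr 1; abel
      have e2 : -(‖a‖ * t) ≤ ⟪a, xh - x (K n)⟫ :=
        neg_le_of_abs_le (abs_real_inner_le_norm _ _)
      have e3 : -(‖gradient f (x (K n))‖ * t) ≤ ⟪gradient f (x (K n)), xh - x (K n)⟫ :=
        neg_le_of_abs_le (abs_real_inner_le_norm _ _)
      have e4 : (φ (x (K n))).toReal ≤ p 0 - f (x (K n)) := by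
        have := hp0 (K n)
        simp only [hp] at this ⊢
        linarith
      have e5 : ‖gradient f (x (K n))‖ * t ≤ (‖gradient f xstar‖ + 1) * t := by gcongr
      have e6 : gh / 2 * t ^ 2 ≤ C1 + C2 * t := by
        rw [hC2]
        linarith
      have e7 : C1 ≤ C1 / s * t := by
        rw [div_mul_eq_mul_div, le_div_iff₀ hs0]
        gcongr
      have htp : 0 < t := lt_of_lt_of_le hs0 hh
      have e8 : gh / 2 * t ≤ C1 / s + C2 := by
        have : (gh / 2 * t) * t ≤ (C1 / s + C2) * t := by nlinarith
        exact le_of_mul_le_mul_right this htp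
      have e9 : gh / 2 * s ≤ C1 / s + C2 := le_trans (by gcongr) e8
      have e10 : gh ≤ G := by
        rw [hG, le_div_iff₀ hs0]
        linarith
      linarith
    have hd1 : dist (x (K n)) xstar < r := by linarith
    have hd2 : dist xh xstar < r := by
      have := dist_triangle xh (x (K n)) xstar
      rw [dist_eq_norm xh (x (K n))] at this
      linarith
    have hstr' := hstr _ _ hd1 hd2
    have hmain : (1 - δ) * gh / 2 * t ^ 2 < ε' * t := by
      simp only [hp] at hfail'
      rw [← ht] at hstr'
      linarith
    have htp : 0 < t := by
      rcases ht0.lt_or_eq with h | h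
      · exact h
      · rw [← h] at hmain; simp at hmain
    have hgt : (1 - δ) * (gh * t) < 2 * ε' := by
      have : ((1 - δ) * gh / 2 * t) * t < ε' * t := by nlinarith
      have := lt_of_mul_lt_mul_right this ht0
      linarith
    have hgt2 : τ * (gh * t) < ε := by
      have e : 2 * ε' = (1 - δ) * (ε / τ / 2) := by rw [hε']; ring
      rw [e] at hgt
      have h := lt_of_mul_lt_mul_left hgt h1δ.le
      have h' : gh * t < ε / τ := lt_of_lt_of_le h (by
        have : 0 < ε / τ := by positivity
        linarith)
      rw [lt_div_iff₀ hτ0] at h'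
      linarith
    have hle : ‖x (K n + 1) - x (K n)‖ ≤ t := by
      obtain ⟨-, c1⟩ := aux_prox hbot (hM.isMin (K n)) hxt
      obtain ⟨-, c2⟩ := aux_prox hbot hxh (hdom (K n + 1))
      rw [← ht] at c1 c2
      have hlt : gh < γ (K n) := by rw [hγτ]; nlinarith
      by_contra hh
      push Not at hh
      have : t ^ 2 < ‖x (K n + 1) - x (K n)‖ ^ 2 := by gcongr
      nlinarith
    calc γ (K n) * ‖x (K n + 1) - x (K n)‖ ≤ γ (K n) * t := by gcongr
      _ = τ * (gh * t) := by rw [hγτ]; ring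
      _ < ε := hgt2
  refine ⟨⟨hstar, fun n => x (K n + 1),
    fun n => -gradient f (x (K n)) - γ (K n) • (x (K n + 1) - x (K n)), hconv1, ?_, ?_, ?_⟩, key⟩
  · exact hcont xstar hstar _ (fun j => hdom _) hconv1
  · simpa using hgK.neg.sub key
  · intro n
    exact aux_frechet hbot (lt_of_lt_of_le hγmin (hγ _)) (hdom _) (hM.isMin _)
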